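/- arXiv:2605.27012 — 4 statements merged into one kernel-verified Lean document; each statement's English description precedes it below -/
import Mathlib

section
/- Optimality of the oracle trust score (counting-power maximality among thresholding rules): let α ∈ (0,1) and suppose τ*_α ∈ [α,1) satisfies mFCR(S*, τ*_α) = α, where S*(x) = 1 − T^or(x). Then for every measurable S':𝒳→ℝ and every τ' ∈ ℝ with P(S' ≤ τ') > 0 and mFCR(S', τ') ≤ α, one has cPOW(S*, τ*_α) ≥ cPOW(S', τ'). -/
open MeasureTheory

noncomputable section

/-- The marginal false coverage rate of the thresholding rule `{S ≤ τ}`: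
`mFCR(S,τ) = ∫_{{S≤τ}} S* dP / P({S ≤ τ})`. -/
def mFCR {𝓧 : Type*} [MeasurableSpace 𝓧] (P : Measure 𝓧) (Sstar : 𝓧 → ℝ)
    (S : 𝓧 → ℝ) (τ : ℝ) : ℝ :=
  (∫ x in {x | S x ≤ τ}, Sstar x ∂P) / (P {x | S x ≤ τ}).toReal

/-- The counting power of the thresholding rule `{S ≤ τ}`:
`cPOW(S,τ) = ∫_{{S≤τ}} (1 − S*) dP`. -/
def cPOW {𝓧 : Type*} [MeasurableSpace 𝓧] (P : Measure 𝓧) (Sstar : 𝓧 → ℝ)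
    (S : 𝓧 → ℝ) (τ : ℝ) : ℝ :=
  ∫ x in {x | S x ≤ τ}, (1 - Sstar x) ∂P

/-- **Optimality of the oracle trust score** (Theorem 3): with `S* = 1 − T^or` the
conditional non-coverage probability, if `τ*_α ∈ [α,1)` satisfies `mFCR(S*,τ*_α) = α`,
then for every measurable score `S'` and threshold `τ'` with `P(S' ≤ τ') > 0` and
`mFCR(S',τ') ≤ α`, one has `cPOW(S*,τ*_α) ≥ cPOW(S',τ')`. -/
theorem oracle_trust_score_optimal
    {𝓧 : Type*} [MeasurableSpace 𝓧] (P : Measure 𝓧) [IsProbabilityMeasure P]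
    (Sstar : 𝓧 → ℝ) (hSmeas : Measurable Sstar)
    (hS01 : ∀ x, Sstar x ∈ Set.Icc (0:ℝ) 1)
    (α : ℝ) (hα : α ∈ Set.Ioo (0:ℝ) 1)
    (τstar : ℝ) (hτstar : τstar ∈ Set.Ico α 1)
    (hpos : P {x | Sstar x ≤ τstar} ≠ 0)
    (hopt : mFCR P Sstar Sstar τstar = α)
    (S' : 𝓧 → ℝ) (hS'meas : Measurable S') (τ' : ℝ)
    (hpos' : P {x | S' x ≤ τ'} ≠ 0)
    (hfcr' : mFCR P Sstar S' τ' ≤ α) :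
    cPOW P Sstar S' τ' ≤ cPOW P Sstar Sstar τstar := by
  obtain ⟨h1, h2⟩ := hτstar
  obtain ⟨ha0, ha1⟩ := hα
  have hi : Integrable Sstar P :=
    Integrable.of_bound hSmeas.aestronglyMeasurable 1
      (Filter.Eventually.of_forall fun x => by
        rw [Real.norm_eq_abs, abs_le]; constructor <;> linarith [(hS01 x).1, (hS01 x).2])
  have mA : MeasurableSet {x | Sstar x ≤ τstar} := measurableSet_le hSmeas measurable_const
  have mB : MeasurableSet {x | S' x ≤ τ'} := measurableSet_le hS'meas measurable_const
  have key : ∀ (T : Set 𝓧) (c : ℝ), ∫ x in T, (c - Sstar x) ∂P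
      = c * (P T).toReal - ∫ x in T, Sstar x ∂P := by
    intro T c
    rw [integral_sub (integrable_const c) hi.integrableOn]
    simp [Measure.real, mul_comm]
  unfold mFCR at hopt hfcr'
  have pA : 0 < (P {x | Sstar x ≤ τstar}).toReal :=
    ENNReal.toReal_pos hpos (measure_ne_top _ _)
  have pB : 0 < (P {x | S' x ≤ τ'}).toReal :=
    ENNReal.toReal_pos hpos' (measure_ne_top _ _)
  rw [div_eq_iff pA.ne'] at hopt
  rw [div_le_iff₀ pB] at hfcr'
  unfold cPOW
  rcases h1.eq_or_lt with h | h
  · subst h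
    have iα : Integrable (fun x => α - Sstar x) P := (integrable_const α).sub hi
    have hA0 : ∫ x in {x | Sstar x ≤ α}, (α - Sstar x) ∂P = 0 := by
      rw [key]; linarith
    rw [setIntegral_eq_zero_iff_of_nonneg_ae
      ((ae_restrict_iff' mA).2 (Filter.Eventually.of_forall fun x hx => sub_nonneg.2 hx))
      iα.integrableOn] at hA0
    have hA1 := (ae_restrict_iff' mA).1 hA0
    have hge : ∀ᵐ x ∂P, α ≤ Sstar x := by
      filter_upwards [hA1] with x hx
      by_contra hc
      have := hx (le_of_not_ge hc)
      simp only [Pi.zero_apply] at this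
      linarith
    have hnn : 0 ≤ᵐ[P.restrict {x | S' x ≤ τ'}] fun x => Sstar x - α := by
      filter_upwards [ae_restrict_of_ae hge] with x hx
      exact sub_nonneg.2 hx
    have hB0 : ∫ x in {x | S' x ≤ τ'}, (Sstar x - α) ∂P = 0 := by
      apply le_antisymm _ (integral_nonneg_of_ae hnn)
      have e := key {x | S' x ≤ τ'} α
      have e2 : ∫ x in {x | S' x ≤ τ'}, (Sstar x - α) ∂P
          = -∫ x in {x | S' x ≤ τ'}, (α - Sstar x) ∂P := by
        rw [← integral_neg]; simp
      linarith
    rw [setIntegral_eq_zero_iff_of_nonneg_ae hnn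
      (hi.sub (integrable_const α)).integrableOn] at hB0
    have hB1 := (ae_restrict_iff' mB).1 hB0
    apply setIntegral_mono_set ((integrable_const (1:ℝ)).sub hi).integrableOn
    · exact Filter.Eventually.of_forall fun x => sub_nonneg.2 (hS01 x).2
    · filter_upwards [hB1] with x hx hxB
      have := hx hxB
      simp only [Pi.zero_apply] at this
      change Sstar x ≤ α
      linarith
  · have hmax : ∫ x in {x | S' x ≤ τ'}, (τstar - Sstar x) ∂P
        ≤ ∫ x in {x | Sstar x ≤ τstar}, (τstar - Sstar x) ∂P := by
      have := setIntegral_le_nonneg (μ := P) (f := fun x => τstar - Sstar x) mB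
        (measurable_const.sub hSmeas).stronglyMeasurable ((integrable_const τstar).sub hi)
      simpa only [sub_nonneg] using this
    rw [key, key] at hmax
    rw [key, key]
    have hd : 0 < τstar - α := sub_pos.2 h
    have hm := mul_le_mul_of_nonneg_left hmax (sub_pos.2 ha1).le
    have hf := mul_le_mul_of_nonneg_left hfcr' (sub_pos.2 h2).le
    refine le_of_mul_le_mul_left ?_ hd
    rw [hopt] at hm ⊢
    nlinarith

end
end

section
/- Uniformity of tie-broken conformal p-values under exchangeability: let V_1,…,V_{n+1} be real-valued random variables whose joint law is invariant under every permutation of the n+1 indices, and let U be a Uniform(0,1) random variable independent of (V_1,…,V_{n+1}). Define p = [Σ_{i=1}^n 1(V_i > V_{n+1}) + U·(1 + Σ_{i=1}^n 1(V_i = V_{n+1}))]/(n+1). Then p is uniformly distributed on (0,1); moreover, p is independent of the unordered multiset {V_1,…,V_{n+1}}, i.e. for every t ∈ [0,1], P(p ≤ t | σ-algebra generated by the symmetric functions of (V_1,…,V_{n+1})) = t almost surely. -/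
open MeasureTheory ProbabilityTheory
open scoped Classical

noncomputable section

/-- The tie-broken conformal p-value for test value `V_{n+1}` (index `n`) against
calibration values `V_1,…,V_n` (indices `0,…,n−1`). -/
def tbPval {Ω : Type*} (n : ℕ) (V : ℕ → Ω → ℝ) (U : Ω → ℝ) (ω : Ω) : ℝ :=
  ((∑ i ∈ Finset.range n, if V n ω < V i ω then (1 : ℝ) else 0)
    + U ω * (1 + ∑ i ∈ Finset.range n, if V i ω = V n ω then (1 : ℝ) else 0)) / (n + 1)

/-- The σ-algebra generated by the symmetric (permutation-invariant) measurable functions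
of `(V_1,…,V_{n+1})`, i.e. the information in the unordered multiset `{V_1,…,V_{n+1}}`. -/
def symSigma {Ω : Type*} [MeasurableSpace Ω] (n : ℕ) (V : ℕ → Ω → ℝ) :
    MeasurableSpace Ω :=
  ⨆ f ∈ {f : (Fin (n + 1) → ℝ) → ℝ | Measurable f ∧
      ∀ σ : Equiv.Perm (Fin (n + 1)), ∀ v, f (v ∘ σ) = f v},
    MeasurableSpace.comap (fun ω => f (fun i : Fin (n + 1) => V i ω)) inferInstance

theorem tb_comb {ι : Type*} (v : ι → ℝ) (G : ℝ → ℝ) (S : Finset ι) :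
    ∑ k ∈ S, (G (((S.filter (fun i => v k < v i)).card : ℝ) + ((S.filter (fun i => v i = v k)).card : ℝ))
        - G ((S.filter (fun i => v k < v i)).card : ℝ)) / ((S.filter (fun i => v i = v k)).card : ℝ)
      = G (S.card : ℝ) - G 0 := by
  induction S using Finset.strongInduction with
  | H S ih =>
    rcases S.eq_empty_or_nonempty with rfl | hne
    · simp
    obtain ⟨k0, hk0, hmin⟩ := S.exists_min_image v hne
    set S' := S.filter (fun i => v k0 < v i) with hS'
    set M := S.filter (fun i => v i = v k0) with hM
    have hss : S' ⊂ S := by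
      refine (Finset.filter_ssubset).2 ⟨k0, hk0, by simp⟩
    have hMS : S.filter (fun i => ¬ (v k0 < v i)) = M := by
      apply Finset.filter_congr
      intro i hi
      have := hmin i hi
      constructor
      · intro h; linarith [not_lt.1 h]
      · intro h; rw [h]; simp
    have hcard : (S'.card : ℝ) + (M.card : ℝ) = S.card := by
      rw [← hMS]
      exact_mod_cast Finset.card_filter_add_card_filter_not (s := S) (fun i => v k0 < v i)
    have hM0 : (M.card : ℝ) ≠ 0 := by
      have : k0 ∈ M := by simp [hM, hk0]
      exact_mod_cast (Finset.card_pos.2 ⟨k0, this⟩).ne'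
    rw [← Finset.sum_filter_add_sum_filter_not S (fun i => v k0 < v i), hMS]
    have h1 := ih S' hss
    have h2 : ∀ k ∈ S', S.filter (fun i => v k < v i) = S'.filter (fun i => v k < v i) ∧
        S.filter (fun i => v i = v k) = S'.filter (fun i => v i = v k) := by
      intro k hk
      have hk' : v k0 < v k := (Finset.mem_filter.1 hk).2
      constructor
      · ext i; simp only [hS', Finset.mem_filter]
        constructor
        · rintro ⟨a, b⟩; exact ⟨⟨a, by linarith⟩, b⟩
        · rintro ⟨⟨a, _⟩, b⟩; exact ⟨a, b⟩
      · ext i; simp only [hS', Finset.mem_filter]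
        constructor
        · rintro ⟨a, b⟩; exact ⟨⟨a, by linarith⟩, b⟩
        · rintro ⟨⟨a, _⟩, b⟩; exact ⟨a, b⟩
    have h3 : ∀ k ∈ M, S.filter (fun i => v k < v i) = S' ∧ S.filter (fun i => v i = v k) = M := by
      intro k hk
      have hk' : v k = v k0 := (Finset.mem_filter.1 hk).2
      simp only [hk', hS', hM, and_self]
    have e1 := Finset.sum_congr (rfl : S' = S') (fun k hk => by
      rw [(h2 k hk).1, (h2 k hk).2] :
      ∀ k ∈ S', (G (((S.filter (fun i => v k < v i)).card : ℝ) + ((S.filter (fun i => v i = v k)).card : ℝ))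
        - G ((S.filter (fun i => v k < v i)).card : ℝ)) / ((S.filter (fun i => v i = v k)).card : ℝ)
       = (G (((S'.filter (fun i => v k < v i)).card : ℝ) + ((S'.filter (fun i => v i = v k)).card : ℝ))
        - G ((S'.filter (fun i => v k < v i)).card : ℝ)) / ((S'.filter (fun i => v i = v k)).card : ℝ))
    have e2 := Finset.sum_congr (rfl : M = M) (fun k hk => by
      rw [(h3 k hk).1, (h3 k hk).2, hcard] :
      ∀ k ∈ M, (G (((S.filter (fun i => v k < v i)).card : ℝ) + ((S.filter (fun i => v i = v k)).card : ℝ))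
        - G ((S.filter (fun i => v k < v i)).card : ℝ)) / ((S.filter (fun i => v i = v k)).card : ℝ)
       = (G (S.card : ℝ) - G (S'.card : ℝ)) / (M.card : ℝ))
    rw [e1, e2, h1, Finset.sum_const, nsmul_eq_mul]
    field_simp
    ring

def tbQ {n : ℕ} (k : Fin (n + 1)) (u : ℝ) (v : Fin (n + 1) → ℝ) : ℝ :=
  ((∑ i, if v k < v i then (1 : ℝ) else 0)
    + u * (∑ i, if v i = v k then (1 : ℝ) else 0)) / (n + 1)

theorem tbQ_perm {n : ℕ} (k : Fin (n + 1)) (u : ℝ) (v : Fin (n + 1) → ℝ)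
    (σ : Equiv.Perm (Fin (n + 1))) : tbQ k u (v ∘ σ) = tbQ (σ k) u v := by
  unfold tbQ
  simp only [Function.comp]
  rw [Equiv.sum_comp σ (fun i => if v (σ k) < v i then (1 : ℝ) else 0),
    Equiv.sum_comp σ (fun i => if v i = v (σ k) then (1 : ℝ) else 0)]

theorem tbPval_eq {Ω : Type*} (n : ℕ) (V : ℕ → Ω → ℝ) (U : Ω → ℝ) (ω : Ω) :
    tbPval n V U ω = tbQ (Fin.last n) (U ω) (fun i : Fin (n + 1) => V i ω) := by
  unfold tbPval tbQ
  rw [Fin.sum_univ_castSucc, Fin.sum_univ_castSucc]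
  simp only [Fin.val_last, Fin.val_castSucc, lt_irrefl, if_true, if_false, add_zero]
  rw [Finset.sum_range (fun i => if V n ω < V i ω then (1 : ℝ) else 0),
    Finset.sum_range (fun i => if V i ω = V n ω then (1 : ℝ) else 0), add_comm (1 : ℝ)]

theorem tbQ_meas {n : ℕ} (k : Fin (n + 1)) :
    Measurable (fun z : ℝ × (Fin (n + 1) → ℝ) => tbQ k z.1 z.2) := by
  have hc : ∀ i : Fin (n + 1), Measurable (fun z : ℝ × (Fin (n + 1) → ℝ) => z.2 i) :=
    fun i => (measurable_pi_apply i).comp measurable_snd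
  unfold tbQ
  refine Measurable.div_const (Measurable.add (Finset.measurable_sum _ fun i _ => ?_)
    (measurable_fst.mul (Finset.measurable_sum _ fun i _ => ?_))) _
  · exact Measurable.ite (measurableSet_lt (hc k) (hc i)) measurable_const measurable_const
  · exact Measurable.ite (measurableSet_eq_fun (hc i) (hc k)) measurable_const measurable_const

theorem tb_vol (a m s : ℝ) (hm : 0 < m) :
    (volume.restrict (Set.Ioo (0:ℝ) 1)) {u | a + u * m ≤ s}
      = ENNReal.ofReal ((min s (a + m) - min s a) / m) := by
  have h1 : {u : ℝ | a + u * m ≤ s} = Set.Iic ((s - a) / m) := by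
    ext u
    simp only [Set.mem_setOf_eq, Set.mem_Iic, le_div_iff₀ hm]
    constructor <;> intro h <;> linarith
  rw [h1, Measure.restrict_congr_set (Ioo_ae_eq_Ioc (μ := volume) (a := (0:ℝ)) (b := 1)),
    Measure.restrict_apply measurableSet_Iic, Set.inter_comm, Set.Ioc_inter_Iic, Real.volume_Ioc, sub_zero]
  rcases lt_or_ge s a with h | h
  · rw [min_eq_left (by linarith : s ≤ a + m), min_eq_left h.le, sub_self, zero_div,
      ENNReal.ofReal_zero, ENNReal.ofReal_eq_zero]
    exact (min_le_right _ _).trans (div_nonpos_of_nonpos_of_nonneg (by linarith) hm.le)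
  · rw [min_eq_right h]
    congr 1
    rcases le_total s (a + m) with h' | h'
    · rw [min_eq_left h', min_eq_right]
      rw [div_le_one hm]; linarith
    · rw [min_eq_right h', min_eq_left]
      · field_simp; ring
      · rw [one_le_div hm]; linarith

theorem tb_sum {n : ℕ} (v : Fin (n + 1) → ℝ) (t : ℝ) (ht : t ∈ Set.Icc (0:ℝ) 1) :
    ∑ k, (volume.restrict (Set.Ioo (0:ℝ) 1)) {u | tbQ k u v ≤ t}
      = ENNReal.ofReal ((n + 1) * t) := by
  have hN : (0:ℝ) < n + 1 := by positivity
  have hm : ∀ k, (0:ℝ) < ((Finset.univ.filter (fun i => v i = v k)).card : ℝ) := by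
    intro k
    exact_mod_cast Finset.card_pos.2 ⟨k, by simp⟩
  have h1 : ∀ k, (volume.restrict (Set.Ioo (0:ℝ) 1)) {u | tbQ k u v ≤ t} = _ := fun k => by
    have : {u | tbQ k u v ≤ t} = {u | ((Finset.univ.filter (fun i => v k < v i)).card : ℝ) +
        u * ((Finset.univ.filter (fun i => v i = v k)).card : ℝ) ≤ (n + 1) * t} := by
      ext u
      simp only [tbQ, Finset.sum_boole, Set.mem_setOf_eq]
      rw [div_le_iff₀ hN, mul_comm t]
    rw [this, tb_vol _ _ _ (hm k)]
  rw [Finset.sum_congr rfl (fun k _ => h1 k), ← ENNReal.ofReal_sum_of_nonneg]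
  · congr 1
    rw [tb_comb v (fun y => min ((n + 1) * t) y) Finset.univ]
    simp only [Finset.card_univ, Fintype.card_fin]
    push_cast
    rw [min_eq_left (by nlinarith [ht.2]), min_eq_right (by nlinarith [ht.1])]
    ring
  · intro k _
    refine div_nonneg (sub_nonneg.2 (min_le_min_left _ ?_)) (hm k).le
    linarith [hm k]

theorem tb_key {Ω : Type*} [MeasurableSpace Ω] (P : Measure Ω) [IsProbabilityMeasure P]
    (n : ℕ) (V : ℕ → Ω → ℝ) (U : Ω → ℝ)
    (hV : ∀ i, Measurable (V i)) (hU : Measurable U)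
    (hexch : ∀ σ : Equiv.Perm (Fin (n + 1)),
      Measure.map (fun ω => fun i : Fin (n + 1) => V (σ i) ω) P
        = Measure.map (fun ω => fun i : Fin (n + 1) => V i ω) P)
    (hUunif : Measure.map U P = volume.restrict (Set.Ioo (0:ℝ) 1))
    (hUindep : IndepFun U (fun ω => fun i : Fin (n + 1) => V i ω) P)
    (t : ℝ) (ht : t ∈ Set.Icc (0:ℝ) 1) (A : Set (Fin (n + 1) → ℝ)) (hA : MeasurableSet A)
    (hAs : ∀ σ : Equiv.Perm (Fin (n + 1)), ∀ v, v ∘ σ ∈ A ↔ v ∈ A) :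
    P ({ω | tbPval n V U ω ≤ t} ∩ (fun ω => fun i : Fin (n + 1) => V i ω) ⁻¹' A)
      = ENNReal.ofReal t * P ((fun ω => fun i : Fin (n + 1) => V i ω) ⁻¹' A) := by
  set W : Ω → Fin (n + 1) → ℝ := fun ω => fun i : Fin (n + 1) => V i ω with hW
  have hWm : Measurable W := measurable_pi_lambda _ fun i => hV i
  set μ := Measure.map W P with hμ
  haveI : IsProbabilityMeasure μ := Measure.isProbabilityMeasure_map hWm.aemeasurable
  haveI : IsProbabilityMeasure (volume.restrict (Set.Ioo (0:ℝ) 1)) := by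
    rw [← hUunif]; exact Measure.isProbabilityMeasure_map hU.aemeasurable
  have hjoint : Measure.map (fun ω => (U ω, W ω)) P = (volume.restrict (Set.Ioo (0:ℝ) 1)).prod μ := by
    rw [(indepFun_iff_map_prod_eq_prod_map_map hU.aemeasurable hWm.aemeasurable).1 hUindep, hUunif]
  let F : Fin (n + 1) → (Fin (n + 1) → ℝ) → ENNReal := fun k v =>
    (volume.restrict (Set.Ioo (0:ℝ) 1)) {u | tbQ k u v ≤ t}
  have hQm : ∀ k, MeasurableSet {z : ℝ × (Fin (n + 1) → ℝ) | tbQ k z.1 z.2 ≤ t} := fun k =>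
    measurableSet_le (tbQ_meas k) measurable_const
  have hFm : ∀ k, Measurable (F k) := fun k => measurable_measure_prodMk_right (hQm k)
  have hFσ : ∀ (σ : Equiv.Perm (Fin (n + 1))) k v, F k (v ∘ σ) = F (σ k) v := by
    intro σ k v
    simp only [F, tbQ_perm]
  have hlast : P ({ω | tbPval n V U ω ≤ t} ∩ W ⁻¹' A) = ∫⁻ v, A.indicator (F (Fin.last n)) v ∂μ := by
    have hB : MeasurableSet ({z : ℝ × (Fin (n + 1) → ℝ) | tbQ (Fin.last n) z.1 z.2 ≤ t} ∩ Prod.snd ⁻¹' A) :=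
      (hQm _).inter (measurable_snd hA)
    have : {ω | tbPval n V U ω ≤ t} ∩ W ⁻¹' A = (fun ω => (U ω, W ω)) ⁻¹'
        ({z : ℝ × (Fin (n + 1) → ℝ) | tbQ (Fin.last n) z.1 z.2 ≤ t} ∩ Prod.snd ⁻¹' A) := by
      ext ω
      simp only [tbPval_eq, Set.mem_inter_iff, Set.mem_setOf_eq, Set.mem_preimage, hW]
    rw [this, ← Measure.map_apply (hU.prodMk hWm) hB, hjoint, Measure.prod_apply_symm hB]
    apply lintegral_congr
    intro v
    by_cases hv : v ∈ A
    · simp [hv, F, Set.preimage]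
    · simp [hv, Set.preimage]
  have hsame : ∀ k, ∫⁻ v, A.indicator (F k) v ∂μ = ∫⁻ v, A.indicator (F (Fin.last n)) v ∂μ := by
    intro k
    let σ : Equiv.Perm (Fin (n + 1)) := Equiv.swap (Fin.last n) k
    have hcm : Measurable (fun v : Fin (n + 1) → ℝ => v ∘ σ) :=
      measurable_pi_lambda _ fun i => measurable_pi_apply _
    have hmap : Measure.map (fun v : Fin (n + 1) → ℝ => v ∘ σ) μ = μ := by
      rw [hμ, Measure.map_map hcm hWm]
      exact hexch σ
    conv_rhs => rw [← hmap]
    rw [lintegral_map ((hFm _).indicator hA) hcm]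
    apply lintegral_congr
    intro v
    by_cases hv : v ∈ A
    · rw [Set.indicator_of_mem hv, Set.indicator_of_mem ((hAs σ v).2 hv), hFσ]
      simp [σ]
    · rw [Set.indicator_of_notMem hv, Set.indicator_of_notMem (fun h => hv ((hAs σ v).1 h))]
  have hsum : ∑ k, ∫⁻ v, A.indicator (F k) v ∂μ = ENNReal.ofReal ((n + 1) * t) * μ A := by
    rw [← lintegral_finsetSum _ (fun k _ => (hFm k).indicator hA), ← setLIntegral_const,
      ← lintegral_indicator hA]
    apply lintegral_congr
    intro v
    by_cases hv : v ∈ A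
    · simp only [Set.indicator_of_mem hv]
      exact tb_sum v t ht
    · simp [hv]
  rw [Finset.sum_congr rfl (fun k _ => hsame k), Finset.sum_const, Finset.card_univ,
    Fintype.card_fin, nsmul_eq_mul, ENNReal.ofReal_mul (by positivity), mul_assoc] at hsum
  have hc : ENNReal.ofReal ((n:ℝ) + 1) = ((n + 1 : ℕ) : ENNReal) := by
    rw [← ENNReal.ofReal_natCast]; push_cast; rfl
  rw [hc] at hsum
  rw [hlast, ← Measure.map_apply hWm hA]
  exact (ENNReal.mul_right_inj (by simp) (ENNReal.natCast_ne_top _)).1 hsum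

theorem tb_sym {Ω : Type*} [MeasurableSpace Ω] (n : ℕ) (V : ℕ → Ω → ℝ) (S : Set Ω)
    (hS : MeasurableSet[symSigma n V] S) :
    ∃ A : Set (Fin (n + 1) → ℝ), MeasurableSet A ∧
      (∀ σ : Equiv.Perm (Fin (n + 1)), ∀ v, v ∘ σ ∈ A ↔ v ∈ A) ∧
      (fun ω => fun i : Fin (n + 1) => V i ω) ⁻¹' A = S := by
  let m' : MeasurableSpace (Fin (n + 1) → ℝ) :=
    { MeasurableSet' := fun A => MeasurableSet A ∧
        ∀ σ : Equiv.Perm (Fin (n + 1)), ∀ v, v ∘ σ ∈ A ↔ v ∈ A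
      measurableSet_empty := ⟨MeasurableSet.empty, by simp⟩
      measurableSet_compl := fun A h => ⟨h.1.compl, fun σ v => not_congr (h.2 σ v)⟩
      measurableSet_iUnion := fun f h => ⟨MeasurableSet.iUnion fun i => (h i).1, fun σ v => by
        simp only [Set.mem_iUnion, fun i => (h i).2 σ v]⟩ }
  have hle : symSigma n V ≤ MeasurableSpace.comap (fun ω => fun i : Fin (n + 1) => V i ω) m' := by
    refine iSup₂_le fun f hf => ?_
    rintro _ ⟨B, hB, rfl⟩
    refine ⟨f ⁻¹' B, ⟨hf.1 hB, fun σ v => ?_⟩, rfl⟩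
    simp only [Set.mem_preimage, hf.2 σ v]
  obtain ⟨A, hA, h⟩ := hle S hS
  exact ⟨A, hA.1, hA.2, h⟩

/-- **Uniformity of tie-broken conformal p-values under exchangeability**: if
`(V_1,…,V_{n+1})` is exchangeable and `U ~ Uniform(0,1)` is independent of the `V`'s, then
`p = [Σ 1(V_i > V_{n+1}) + U·(1 + Σ 1(V_i = V_{n+1}))]/(n+1)` is uniform on `(0,1)` and is
independent of the unordered multiset of the `V`'s: for every `t ∈ [0,1]`,
`P(p ≤ t | symmetric σ-algebra) = t` a.s. -/
theorem tie_broken_conformal_pvalue_uniform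
    {Ω : Type*} [MeasurableSpace Ω] (P : Measure Ω) [IsProbabilityMeasure P]
    (n : ℕ) (V : ℕ → Ω → ℝ) (U : Ω → ℝ)
    (hV : ∀ i, Measurable (V i)) (hU : Measurable U)
    (hexch : ∀ σ : Equiv.Perm (Fin (n + 1)),
      Measure.map (fun ω => fun i : Fin (n + 1) => V (σ i) ω) P
        = Measure.map (fun ω => fun i : Fin (n + 1) => V i ω) P)
    (hUunif : Measure.map U P = volume.restrict (Set.Ioo (0:ℝ) 1))
    (hUindep : IndepFun U (fun ω => fun i : Fin (n + 1) => V i ω) P) :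
    Measure.map (tbPval n V U) P = volume.restrict (Set.Ioo (0:ℝ) 1) ∧
    ∀ t ∈ Set.Icc (0:ℝ) 1,
      P[(fun ω => if tbPval n V U ω ≤ t then (1:ℝ) else 0) | symSigma n V]
        =ᵐ[P] fun _ => t := by
  have key := tb_key P n V U hV hU hexch hUunif hUindep
  have hWm : Measurable (fun ω => fun i : Fin (n + 1) => V i ω) :=
    measurable_pi_lambda _ fun i => hV i
  have hpm : Measurable (tbPval n V U) := by
    have : tbPval n V U = fun ω => tbQ (Fin.last n) (U ω) (fun i : Fin (n + 1) => V i ω) :=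
      funext fun ω => tbPval_eq n V U ω
    rw [this]
    exact (tbQ_meas (Fin.last n)).comp (hU.prodMk hWm)
  constructor
  · have hcdf : ∀ t ∈ Set.Icc (0:ℝ) 1, P {ω | tbPval n V U ω ≤ t} = ENNReal.ofReal t := by
      intro t ht
      have := key t ht Set.univ MeasurableSet.univ (by simp)
      simpa using this
    haveI : IsProbabilityMeasure (Measure.map (tbPval n V U) P) :=
      Measure.isProbabilityMeasure_map hpm.aemeasurable
    apply Measure.ext_of_Iic
    intro t
    rw [Measure.map_apply hpm measurableSet_Iic]
    change P {ω | tbPval n V U ω ≤ t} = _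
    have hv := tb_vol 0 1 t one_pos
    have e : {u : ℝ | 0 + u * 1 ≤ t} = Set.Iic t := by ext u; simp
    rw [e] at hv
    rw [hv]
    rcases lt_or_ge t 0 with h0 | h0
    · rw [min_eq_left (by linarith), min_eq_left h0.le]
      simp only [sub_self, zero_div, ENNReal.ofReal_zero]
      refine measure_mono_null (fun ω hω => ?_) ((hcdf 0 (by simp)).trans (by simp))
      exact le_trans hω h0.le
    rcases le_or_gt t 1 with h1 | h1
    · rw [hcdf t ⟨h0, h1⟩, min_eq_left (by linarith), min_eq_right h0]
      simp
    · rw [min_eq_right (by linarith), min_eq_right h0]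
      simp only [zero_add, sub_zero, div_one, ENNReal.ofReal_one]
      refine le_antisymm prob_le_one ?_
      have := hcdf 1 (by simp)
      rw [ENNReal.ofReal_one] at this
      rw [← this]
      exact measure_mono fun ω hω => le_trans hω h1.le
  · intro t ht
    have hsm : ∀ S, MeasurableSet[symSigma n V] S → MeasurableSet S := by
      intro S hS
      obtain ⟨A, hA, _, rfl⟩ := tb_sym n V S hS
      exact hWm hA
    have hEm : MeasurableSet {ω | tbPval n V U ω ≤ t} := measurableSet_le hpm measurable_const
    have hind : (fun ω => if tbPval n V U ω ≤ t then (1:ℝ) else 0)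
        = {ω | tbPval n V U ω ≤ t}.indicator (fun _ => (1:ℝ)) := by
      ext ω; simp [Set.indicator]
    rw [hind]
    symm
    refine ae_eq_condExp_of_forall_setIntegral_eq (m := symSigma n V) hsm ?_ ?_ ?_ ?_
    · exact (integrable_const _).indicator hEm
    · intro S _ _; exact (integrable_const _).integrableOn
    · intro S hS _
      obtain ⟨A, hA, hAs, rfl⟩ := tb_sym n V S hS
      rw [setIntegral_const, setIntegral_indicator hEm, setIntegral_const, Set.inter_comm,
        measureReal_def, measureReal_def, key t ht A hA hAs]
      simp [ENNReal.toReal_mul, ENNReal.toReal_ofReal ht.1, mul_comm]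
    · exact aestronglyMeasurable_const

end
end

section
/- Equivalence of deterministic-p-value BH selection and the counting-knockoff selection: fix labels δ_1,…,δ_n ∈ {0,1}, calibration scores T_1,…,T_n ∈ ℝ, test scores T_{n+1},…,T_{n+m} ∈ ℝ, and α ∈ (0,1). Define the deterministic p-values p_j = (1 + Σ_{i=1}^n 1{δ_i = 1, T_i ≥ T_{n+j}})/(n+1) for j = 1,…,m, and let S^dt = {j : p_j ≤ α̂} with α̂ = max{a ∈ [0,1] : (α/m)Σ_{j=1}^m 1(p_j ≤ a) ≥ a}. Define the estimated FDP as F̂(τ) = [(1 + Σ_{i=1}^n 1{δ_i = 1, T_i ≥ τ}) / max(1, Σ_{j=1}^m 1{T_{n+j} ≥ τ})] · m/(n+1), the threshold τ̂ = min{τ ∈ {T_{n+1},…,T_{n+m}} : F̂(τ) ≤ α} (with S^ck = ∅ if no such τ exists), and S^ck = {j : T_{n+j} ≥ τ̂}. Then S^dt = S^ck. -/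
open scoped Classical

noncomputable section

/-- The self-consistent BH threshold. -/
def bhThresh (α : ℝ) (m : ℕ) (p : Fin m → ℝ) : ℝ :=
  sSup {a : ℝ | a ∈ Set.Icc (0:ℝ) 1 ∧
    a ≤ (α / m) * ((Finset.univ.filter (fun j : Fin m => p j ≤ a)).card : ℝ)}

/-- The deterministic conformal p-values
`p_j = (1 + Σ_{i≤n} 1{δ_i = 1, T_i ≥ T_{n+j}})/(n+1)`. -/
def dtPval (n : ℕ) (δ : ℕ → Bool) (T : ℕ → ℝ) (j : ℕ) : ℝ :=
  (1 + ((Finset.range n).filter (fun i => δ i = true ∧ T (n + j) ≤ T i)).card) / (n + 1)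

/-- The estimated false discovery proportion of the counting-knockoff procedure. -/
def fdpHat (n m : ℕ) (δ : ℕ → Bool) (T : ℕ → ℝ) (τ : ℝ) : ℝ :=
  ((1 + ((Finset.range n).filter (fun i => δ i = true ∧ τ ≤ T i)).card : ℝ) /
      max 1 ((Finset.univ.filter (fun j : Fin m => τ ≤ T (n + j))).card : ℝ))
    * (m / (n + 1))

theorem fdp_iff_aux (n m : ℕ) (δ : ℕ → Bool) (T : ℕ → ℝ) (α : ℝ) (k : Fin m) :
    fdpHat n m δ T (T (n + k)) ≤ α ↔ dtPval n δ T k ≤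
      (α / m) * ((Finset.univ.filter (fun j : Fin m => T (n + k) ≤ T (n + j))).card : ℝ) := by
  have hm : (0:ℝ) < m := by exact_mod_cast k.pos
  have hn : (0:ℝ) < (n:ℝ) + 1 := by positivity
  have hc : (1:ℝ) ≤ ((Finset.univ.filter
      (fun j : Fin m => T (n + k) ≤ T (n + j))).card : ℝ) := by
    exact_mod_cast Finset.card_pos.mpr ⟨k, by simp⟩
  unfold fdpHat dtPval
  rw [max_eq_right hc]
  generalize ((Finset.univ.filter
      (fun j : Fin m => T (n + k) ≤ T (n + j))).card : ℝ) = c at *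
  have hc0 : 0 < c := by linarith
  rw [div_mul_div_comm, div_le_iff₀ (by positivity), div_mul_eq_mul_div,
    div_le_div_iff₀ hn hm]
  ring_nf

theorem dtPval_anti_aux (n : ℕ) (δ : ℕ → Bool) (T : ℕ → ℝ) (k l : ℕ)
    (h : T (n + k) ≤ T (n + l)) : dtPval n δ T l ≤ dtPval n δ T k := by
  unfold dtPval
  gcongr with i hi

theorem dtPval_mem_aux (n : ℕ) (δ : ℕ → Bool) (T : ℕ → ℝ) (k : ℕ)  :
    0 ≤ dtPval n δ T k := by
  unfold dtPval
  positivity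

theorem dtPval_le_aux (n : ℕ) (δ : ℕ → Bool) (T : ℕ → ℝ) (k : ℕ)  :
    dtPval n δ T k ≤ 1 := by
  unfold dtPval
  have h := Finset.card_filter_le (Finset.range n) (fun i => δ i = true ∧ T (n + k) ≤ T i)
  rw [Finset.card_range] at h
  have h' : (((Finset.range n).filter
    (fun i => δ i = true ∧ T (n + k) ≤ T i)).card : ℝ) ≤ n := by exact_mod_cast h
  rw [div_le_one (by positivity)]
  linarith

theorem bhThresh_le_aux (α : ℝ) (hα : 0 < α) (m : ℕ) (p : Fin m → ℝ) :
    bhThresh α m p ≤ (α / m) *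
      ((Finset.univ.filter (fun j : Fin m => p j ≤ bhThresh α m p)).card : ℝ) := by
  conv_lhs => unfold bhThresh
  apply csSup_le
  · exact ⟨0, ⟨le_rfl, zero_le_one⟩, by positivity⟩
  · intro a ha
    have has : a ≤ bhThresh α m p := le_csSup ⟨1, fun b hb => hb.1.2⟩ ha
    refine ha.2.trans ?_
    gcongr with i hi

/-- **Equivalence of deterministic-p-value BH selection and counting-knockoff selection**
(Lemma S.3): the self-consistent BH selection applied to the deterministic p-values
coincides with the counting-knockoff selection `{j : T_{n+j} ≥ τ̂}`, where
`τ̂ = min{τ ∈ {T_{n+j}} : F̂(τ) ≤ α}` (empty selection if no such `τ` exists). -/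
theorem bh_counting_knockoff_equivalence
    (n m : ℕ) (δ : ℕ → Bool) (T : ℕ → ℝ) (α : ℝ) (hα : α ∈ Set.Ioo (0:ℝ) 1) :
    {j : Fin m | dtPval n δ T j ≤ bhThresh α m (fun j' : Fin m => dtPval n δ T j')}
      = {j : Fin m | ∃ h : ((Finset.univ.image (fun j' : Fin m => T (n + j'))).filter
            (fun τ => fdpHat n m δ T τ ≤ α)).Nonempty,
          ((Finset.univ.image (fun j' : Fin m => T (n + j'))).filter
            (fun τ => fdpHat n m δ T τ ≤ α)).min' h ≤ T (n + j)} := by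
  ext j
  simp only [Set.mem_ofPred_eq]
  constructor
  · intro hj
    have hs := bhThresh_le_aux α hα.1 m (fun j' : Fin m => dtPval n δ T j')
    set s := bhThresh α m (fun j' : Fin m => dtPval n δ T j') with hsdef
    obtain ⟨k, hk, hmin⟩ := Finset.exists_min_image
      (Finset.univ.filter (fun l : Fin m => dtPval n δ T l ≤ s))
      (fun l : Fin m => T (n + l)) ⟨j, by simpa using hj⟩
    simp only [Finset.mem_filter, Finset.mem_univ, true_and] at hk hmin
    have hα0 := hα.1
    have hF : fdpHat n m δ T (T (n + k)) ≤ α := by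
      rw [fdp_iff_aux]
      refine hk.trans (hs.trans ?_)
      refine mul_le_mul_of_nonneg_left (Nat.cast_le.mpr (Finset.card_le_card ?_)) (by positivity)
      intro l hl
      rw [Finset.mem_filter] at hl ⊢
      refine ⟨hl.1, ?_⟩
      exact hmin l hl.2
    have hmem : T (n + k) ∈ (Finset.univ.image (fun j' : Fin m => T (n + j'))).filter
            (fun τ => fdpHat n m δ T τ ≤ α) :=
      Finset.mem_filter.mpr ⟨Finset.mem_image.mpr ⟨k, Finset.mem_univ _, rfl⟩, hF⟩
    exact ⟨⟨_, hmem⟩, (Finset.min'_le _ _ hmem).trans (hmin j hj)⟩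
  · rintro ⟨h, hle⟩
    have hmem := Finset.min'_mem _ h
    rw [Finset.mem_filter, Finset.mem_image] at hmem
    obtain ⟨⟨k, -, hk⟩, hF⟩ := hmem
    rw [← hk] at hF hle
    rw [fdp_iff_aux] at hF
    refine (dtPval_anti_aux n δ T k j hle).trans ?_
    refine le_csSup ⟨1, fun b hb => hb.1.2⟩
      ⟨⟨dtPval_mem_aux n δ T k, dtPval_le_aux n δ T k⟩, hF.trans ?_⟩
    have hα0 := hα.1
    refine mul_le_mul_of_nonneg_left (Nat.cast_le.mpr (Finset.card_le_card ?_)) (by positivity)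
    intro l hl
    rw [Finset.mem_filter] at hl ⊢
    refine ⟨hl.1, ?_⟩
    exact dtPval_anti_aux n δ T k l hl.2

end
end

section
/- Equivalence of FASI and the deterministic-p-value BH selection: fix a class y₀, calibration data (X_i, Y_i), i = 1,…,n, test features X_{n+1},…,X_{n+m}, a score function S^{y₀} : 𝒳 → ℝ, and α ∈ (0,1). Define Q̂_j = [(1 + Σ_{i=1}^n 1{Y_i ≠ y₀, S^{y₀}(X_i) ≥ S^{y₀}(X_{n+j})}) / max(1, Σ_{j'=1}^m 1{S^{y₀}(X_{n+j'}) ≥ S^{y₀}(X_{n+j})})] · m/(n+1) for j = 1,…,m, the threshold τ̂ = min{S^{y₀}(X_{n+j}) : Q̂_j ≤ α, j ∈ {1,…,m}} (with empty selection if no such j exists), and S^FASI = {j : S^{y₀}(X_{n+j}) ≥ τ̂}. Define also the deterministic p-values p_j = (1 + Σ_{i=1}^n 1{Y_i ≠ y₀, S^{y₀}(X_i) ≥ S^{y₀}(X_{n+j})})/(n+1) and S^dt = {j : p_j ≤ α̂} with α̂ = max{a ∈ [0,1] : (α/m)Σ_{j=1}^m 1(p_j ≤ a) ≥ a}. Then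 S^FASI = S^dt. -/
open scoped Classical

noncomputable section

/-- The FASI q-value
`Q̂_j = [(1 + Σ_i 1{Y_i ≠ y₀, S(X_i) ≥ S(X_{n+j})}) / max(1, Σ_{j'} 1{S(X_{n+j'}) ≥ S(X_{n+j})})]·m/(n+1)`. -/
def fasiQ {𝓧 𝓨 : Type*} (n m : ℕ) (X : ℕ → 𝓧) (Y : ℕ → 𝓨) (y₀ : 𝓨)
    (S : 𝓧 → ℝ) (j : ℕ) : ℝ :=
  ((1 + ((Finset.range n).filter
        (fun i => Y i ≠ y₀ ∧ S (X (n + j)) ≤ S (X i))).card : ℝ) /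
      max 1 ((Finset.univ.filter
        (fun j' : Fin m => S (X (n + j)) ≤ S (X (n + j')))).card : ℝ))
    * (m / (n + 1))

/-- The deterministic p-values `p_j = (1 + Σ_i 1{Y_i ≠ y₀, S(X_i) ≥ S(X_{n+j})})/(n+1)`. -/
def dtPvalFasi {𝓧 𝓨 : Type*} (n : ℕ) (X : ℕ → 𝓧) (Y : ℕ → 𝓨) (y₀ : 𝓨)
    (S : 𝓧 → ℝ) (j : ℕ) : ℝ :=
  (1 + ((Finset.range n).filter
      (fun i => Y i ≠ y₀ ∧ S (X (n + j)) ≤ S (X i))).card : ℝ) / (n + 1)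

/-- **Equivalence of FASI and the deterministic-p-value BH selection**: the FASI selection
`S^FASI = {j : S^{y₀}(X_{n+j}) ≥ τ̂}` with `τ̂ = min{S^{y₀}(X_{n+j}) : Q̂_j ≤ α}` (empty if
no such `j` exists) coincides with the self-consistent BH selection applied to the
deterministic p-values `p_j`. -/
theorem fasi_bh_equivalence
    {𝓧 𝓨 : Type*} (n m : ℕ) (X : ℕ → 𝓧) (Y : ℕ → 𝓨) (y₀ : 𝓨)
    (S : 𝓧 → ℝ) (α : ℝ) (hα : α ∈ Set.Ioo (0:ℝ) 1) :
    {j : Fin m | ∃ h : ((Finset.univ.filter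
          (fun j' : Fin m => fasiQ n m X Y y₀ S j' ≤ α)).image
            (fun j' : Fin m => S (X (n + j')))).Nonempty,
        ((Finset.univ.filter
          (fun j' : Fin m => fasiQ n m X Y y₀ S j' ≤ α)).image
            (fun j' : Fin m => S (X (n + j')))).min' h ≤ S (X (n + j))}
      = {j : Fin m | dtPvalFasi n X Y y₀ S j ≤
          bhThresh α m (fun j' : Fin m => dtPvalFasi n X Y y₀ S j')} := by
  classical
  obtain ⟨hα0, hα1⟩ := hα
  ext j
  have hm : (0:ℝ) < m := by exact_mod_cast j.pos
  have hn : (0:ℝ) < (n:ℝ) + 1 := by positivity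
  set p : Fin m → ℝ := fun j' : Fin m => dtPvalFasi n X Y y₀ S j' with hp
  -- antitonicity
  have hanti : ∀ a b : Fin m, S (X (n + a)) ≤ S (X (n + b)) → p b ≤ p a := by
    intro a b hab
    simp only [hp, dtPvalFasi]
    apply div_le_div_of_nonneg_right _ hn.le
    have : ((Finset.range n).filter (fun i => Y i ≠ y₀ ∧ S (X (n + b)) ≤ S (X i))).card ≤
        ((Finset.range n).filter (fun i => Y i ≠ y₀ ∧ S (X (n + a)) ≤ S (X i))).card := by
      apply Finset.card_le_card
      intro i hi
      rw [Finset.mem_filter] at hi ⊢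
      exact ⟨hi.1, hi.2.1, hab.trans hi.2.2⟩
    have h2 := (Nat.cast_le (α := ℝ)).2 this
    linarith
  have hp0 : ∀ a, 0 ≤ p a := by
    intro a
    simp only [hp, dtPvalFasi]
    positivity
  have hp1 : ∀ a, p a ≤ 1 := by
    intro a
    simp only [hp, dtPvalFasi]
    rw [div_le_one hn]
    have : ((Finset.range n).filter
        (fun i => Y i ≠ y₀ ∧ S (X (n + a)) ≤ S (X i))).card ≤ n := by
      simpa using Finset.card_filter_le (Finset.range n)
        (fun i => Y i ≠ y₀ ∧ S (X (n + a)) ≤ S (X i))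
    have h2 := (Nat.cast_le (α := ℝ)).2 this
    linarith
  have hQ : ∀ a : Fin m, fasiQ n m X Y y₀ S a ≤ α ↔ p a ≤ (α / m) *
      ((Finset.univ.filter
        (fun j' : Fin m => S (X (n + a)) ≤ S (X (n + j')))).card : ℝ) := by
    intro a
    have hR : (1:ℝ) ≤ ((Finset.univ.filter
        (fun j' : Fin m => S (X (n + a)) ≤ S (X (n + j')))).card : ℝ) := by
      have : 0 < (Finset.univ.filter
        (fun j' : Fin m => S (X (n + a)) ≤ S (X (n + j')))).card :=
        Finset.card_pos.2 ⟨a, by simp⟩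
      exact_mod_cast this
    simp only [fasiQ, hp, dtPvalFasi]
    rw [max_eq_right hR]
    generalize ((Finset.univ.filter
        (fun j' : Fin m => S (X (n + a)) ≤ S (X (n + j')))).card : ℝ) = R at hR
    have hR0 : 0 < R := by linarith
    rw [div_mul_div_comm, div_le_iff₀ (by positivity), div_le_iff₀ hn, div_mul_eq_mul_div,
      div_mul_eq_mul_div, le_div_iff₀ hm, mul_assoc]
  set A : Set ℝ := {a : ℝ | a ∈ Set.Icc (0:ℝ) 1 ∧
    a ≤ (α / m) * ((Finset.univ.filter (fun j : Fin m => p j ≤ a)).card : ℝ)} with hA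
  have hbdd : BddAbove A := ⟨1, fun a ha => ha.1.2⟩
  have hne : A.Nonempty := ⟨0, ⟨le_rfl, zero_le_one⟩, by positivity⟩
  have hbh : bhThresh α m p = sSup A := rfl
  have hmono : ∀ s t : Finset (Fin m), s ⊆ t → (α / m) * (s.card : ℝ) ≤ (α / m) * (t.card : ℝ) := by
    intro s t hst
    have := (Nat.cast_le (α := ℝ)).2 (Finset.card_le_card hst)
    exact mul_le_mul_of_nonneg_left this (by positivity)
  have hsup : sSup A ≤ (α / m) *
      ((Finset.univ.filter (fun j : Fin m => p j ≤ sSup A)).card : ℝ) := by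
    apply csSup_le hne
    intro a ha
    refine ha.2.trans (hmono _ _ ?_)
    intro i hi
    rw [Finset.mem_filter] at hi ⊢
    exact ⟨hi.1, hi.2.trans (le_csSup hbdd ha)⟩
  simp only [Set.mem_setOf_eq]
  change _ ↔ p j ≤ bhThresh α m p
  rw [hbh]
  constructor
  · rintro ⟨h, hle⟩
    obtain ⟨k, hk, hk2⟩ := Finset.mem_image.1 (Finset.min'_mem _ h)
    rw [← hk2] at hle
    have hk3 := (hQ k).1 (Finset.mem_filter.1 hk).2
    refine (hanti k j hle).trans (le_csSup hbdd ⟨⟨hp0 k, hp1 k⟩, hk3.trans (hmono _ _ ?_)⟩)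
    intro i hi
    rw [Finset.mem_filter] at hi ⊢
    exact ⟨hi.1, hanti k i hi.2⟩
  · intro hj
    obtain ⟨k, hk, hkmin⟩ := Finset.exists_min_image
      (Finset.univ.filter (fun i : Fin m => p i ≤ sSup A)) (fun i => S (X (n + i)))
      ⟨j, by simpa using hj⟩
    have hkQ : fasiQ n m X Y y₀ S k ≤ α := by
      rw [hQ]
      refine ((Finset.mem_filter.1 hk).2.trans hsup).trans (hmono _ _ ?_)
      intro i hi
      exact Finset.mem_filter.2 ⟨Finset.mem_univ _, hkmin i hi⟩
    have hmem : S (X (n + k)) ∈ ((Finset.univ.filter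
          (fun j' : Fin m => fasiQ n m X Y y₀ S j' ≤ α)).image
            (fun j' : Fin m => S (X (n + j')))) :=
      Finset.mem_image.2 ⟨k, Finset.mem_filter.2 ⟨Finset.mem_univ _, hkQ⟩, rfl⟩
    exact ⟨⟨_, hmem⟩, (Finset.min'_le _ _ hmem).trans
      (hkmin j (Finset.mem_filter.2 ⟨Finset.mem_univ _, hj⟩))⟩

end
end
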